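/- (Separated form of the optimal cost decomposition) Under the hypotheses of the cost identity for the certainty-equivalent controller (dynamics X_1 = W_0, X_{t+1} = a X_t + W_t + U_t with independent zero-mean square-integrable W_t; filtration 𝒢_t ⊆ σ(W_0, …, W_{t−1}); Riccati quantities s_t, k_t, g_t; and U_t = −k_t E[X_t | 𝒢_t]), the time-averaged cost satisfies J̄_T = (1/T)·Σ_{t=1}^{T} ( s_t·σ²_{t−1} + g_t·E[(X_t − X̂_t)²] ), where σ²_{t−1} = E[W_{t−1}²]; in particular, among all controllers of the form U_t = −k_t X̂_t with the given gains, the cost is minimized by minimizing the estimation errors E[(X_t − X̂_t)²], since the weights g_t = a² s_{t+1}²/(s_{t+1} + r_t) are nonnegative and the term Σ_t s_t σ²_{t−1} does not depend on the communication scheme. -/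

import Mathlib

open MeasureTheory

/-- A square-integrable variable and its conditional expectation have the same inner product
with the conditional expectation. -/
lemma integral_mul_condExp_self {Ω : Type*} {m m0 : MeasurableSpace Ω} {μ : Measure Ω}
    [IsProbabilityMeasure μ] (hm : m ≤ m0) {X : Ω → ℝ} (hX : MemLp X 2 μ) :
    ∫ ω, X ω * (μ[X|m]) ω ∂μ = ∫ ω, (μ[X|m]) ω ^ 2 ∂μ := by
  have hXm : MemLp (μ[X|m]) 2 μ := hX.condExp one_le_two
  have h := condExp_mul_of_stronglyMeasurable_right (μ := μ) (f := X) (g := μ[X|m])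
    stronglyMeasurable_condExp (hX.integrable_mul hXm) (hX.integrable one_le_two)
  calc ∫ ω, X ω * (μ[X|m]) ω ∂μ = ∫ ω, (μ[X * μ[X|m]|m]) ω ∂μ := (integral_condExp hm).symm
    _ = ∫ ω, (μ[X|m]) ω ^ 2 ∂μ := by
        refine integral_congr_ae ?_
        filter_upwards [h] with ω hω
        rw [hω, Pi.mul_apply, sq]

/-- The mean squared estimation error is the difference of the second moments of the state and
of its estimate. -/
lemma integral_sub_condExp_sq {Ω : Type*} {m m0 : MeasurableSpace Ω} {μ : Measure Ω}
    [IsProbabilityMeasure μ] (hm : m ≤ m0) {X : Ω → ℝ} (hX : MemLp X 2 μ) :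
    ∫ ω, (X ω - (μ[X|m]) ω) ^ 2 ∂μ = ∫ ω, X ω ^ 2 ∂μ - ∫ ω, (μ[X|m]) ω ^ 2 ∂μ := by
  have hXm : MemLp (μ[X|m]) 2 μ := hX.condExp one_le_two
  have hi : Integrable (fun ω => X ω * (μ[X|m]) ω) μ := hX.integrable_mul hXm
  have h : ∀ ω, (X ω - (μ[X|m]) ω) ^ 2
      = X ω ^ 2 + -2 * (X ω * (μ[X|m]) ω) + (μ[X|m]) ω ^ 2 := fun ω => by ring
  simp only [h]
  rw [integral_add (hX.integrable_sq.fun_add (hi.const_mul (-2))) hXm.integrable_sq,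
    integral_add hX.integrable_sq (hi.const_mul (-2)), integral_const_mul,
    integral_mul_condExp_self hm hX]
  ring

/-- Second moment of the next state under certainty-equivalent control with gain `k`. -/
lemma integral_next_state_sq {Ω : Type*} {m m0 : MeasurableSpace Ω} {μ : Measure Ω}
    [IsProbabilityMeasure μ] (hm : m ≤ m0) {X V : Ω → ℝ} (hX : MemLp X 2 μ) (hV : MemLp V 2 μ)
    (hV0 : ∫ ω, V ω ∂μ = 0) {a k : ℝ}
    (hind : ProbabilityTheory.IndepFun (fun ω => a * X ω - k * (μ[X|m]) ω) V μ) :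
    ∫ ω, (a * X ω + V ω + -k * (μ[X|m]) ω) ^ 2 ∂μ =
      a ^ 2 * ∫ ω, X ω ^ 2 ∂μ + (k ^ 2 - 2 * a * k) * ∫ ω, (μ[X|m]) ω ^ 2 ∂μ
        + ∫ ω, V ω ^ 2 ∂μ := by
  have hXm : MemLp (μ[X|m]) 2 μ := hX.condExp one_le_two
  have hi : Integrable (fun ω => X ω * (μ[X|m]) ω) μ := hX.integrable_mul hXm
  have hY : MemLp (fun ω => a * X ω - k * (μ[X|m]) ω) 2 μ :=
    (hX.const_mul a).sub (hXm.const_mul k)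
  have hYV : Integrable (fun ω => (a * X ω - k * (μ[X|m]) ω) * V ω) μ := hY.integrable_mul hV
  have hcross : ∫ ω, (a * X ω - k * (μ[X|m]) ω) * V ω ∂μ = 0 := by
    rw [hind.integral_fun_mul_eq_mul_integral hY.1 hV.1, hV0, mul_zero]
  have h : ∀ ω, (a * X ω + V ω + -k * (μ[X|m]) ω) ^ 2
      = a ^ 2 * X ω ^ 2 + k ^ 2 * (μ[X|m]) ω ^ 2 + -(2 * a * k) * (X ω * (μ[X|m]) ω)
        + 2 * ((a * X ω - k * (μ[X|m]) ω) * V ω) + V ω ^ 2 := fun ω => by ring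
  have hi₁ := hX.integrable_sq.const_mul (a ^ 2)
  have hi₂ := hXm.integrable_sq.const_mul (k ^ 2)
  have hi₃ := hi.const_mul (-(2 * a * k))
  have hi₄ := hYV.const_mul 2
  simp only [h]
  rw [integral_add (((hi₁.fun_add hi₂).fun_add hi₃).fun_add hi₄) hV.integrable_sq,
    integral_add ((hi₁.fun_add hi₂).fun_add hi₃) hi₄, integral_add (hi₁.fun_add hi₂) hi₃,
    integral_add hi₁ hi₂]
  simp only [integral_const_mul]
  rw [hcross, integral_mul_condExp_self hm hX]
  ring

/-- The backward Riccati recursion preserves nonnegativity. -/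
lemma riccati_nonneg {a : ℝ} {T : ℕ} (hT : 1 ≤ T) {q r s : ℕ → ℝ}
    (hq : ∀ t, 1 ≤ t → t ≤ T → 0 ≤ q t)
    (hr : ∀ t, 1 ≤ t → t ≤ T - 1 → 0 < r t) (hsT : s T = q T)
    (hs : ∀ t, 1 ≤ t → t ≤ T - 1 →
      s t = q t + a ^ 2 * s (t + 1) * r t / (s (t + 1) + r t))
    {t : ℕ} (ht : 1 ≤ t) (htT : t ≤ T) : 0 ≤ s t := by
  induction htT using Nat.decreasingInduction with
  | self => exact hsT ▸ hq T hT le_rfl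
  | of_succ n hn ih =>
    have h' := ih (by omega)
    have hrn := hr n ht (by omega)
    have hqn := hq n ht (by omega)
    rw [hs n ht (by omega)]
    positivity

/-- A variable determined by the disturbances before time `t` is independent of the
disturbance at time `t`. -/
lemma indepFun_of_measurable_past {Ω : Type*} {m0 : MeasurableSpace Ω} {μ : Measure Ω}
    {W : ℕ → Ω → ℝ} (hW_meas : ∀ t, Measurable (W t))
    (hW_indep : ProbabilityTheory.iIndepFun W μ) {t : ℕ} {Y : Ω → ℝ}
    (hY : Measurable[⨆ i ∈ Finset.range t, MeasurableSpace.comap (W i) inferInstance] Y) :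
    ProbabilityTheory.IndepFun Y (W t) μ := by
  have h := ProbabilityTheory.indep_iSup_of_disjoint (fun i => (hW_meas i).comap_le)
    hW_indep.iIndep (S := (Finset.range t : Set ℕ)) (T := {t}) (by simp)
  rw [ProbabilityTheory.IndepFun_iff_Indep]
  refine ProbabilityTheory.indep_of_indep_of_le_left ?_ (measurable_iff_comap_le.1 hY)
  simpa using h

section ClosedLoop

variable {Ω : Type*} {m0 : MeasurableSpace Ω} {μ : Measure Ω}
  {a : ℝ} {T : ℕ} {k : ℕ → ℝ} {W : ℕ → Ω → ℝ} {𝒢 : ℕ → MeasurableSpace Ω}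
  {X Xhat U : ℕ → Ω → ℝ}

/-- Under certainty-equivalent control the state at time `t` is square-integrable and is a
function of the disturbances before time `t`. -/
lemma closedLoop_state_regular
    (hW_mem : ∀ t, t ≤ T - 1 → MemLp (W t) 2 μ)
    (h𝒢_le : ∀ t, 1 ≤ t → t ≤ T →
      𝒢 t ≤ ⨆ i ∈ Finset.range t, MeasurableSpace.comap (W i) inferInstance)
    (hX1 : X 1 = W 0)
    (hXhat : ∀ t, 1 ≤ t → t ≤ T → Xhat t = μ[X t|𝒢 t])
    (hU : ∀ t, 1 ≤ t → t ≤ T - 1 → U t = fun ω => -(k t) * Xhat t ω)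
    (hXrec : ∀ t, 1 ≤ t → t ≤ T - 1 →
      X (t + 1) = fun ω => a * X t ω + W t ω + U t ω)
    {t : ℕ} (ht : 1 ≤ t) (htT : t ≤ T) :
    MemLp (X t) 2 μ ∧
      Measurable[⨆ i ∈ Finset.range t, MeasurableSpace.comap (W i) inferInstance] (X t) := by
  have hcomap : ∀ {i n : ℕ}, i < n → MeasurableSpace.comap (W i) inferInstance ≤
      ⨆ i ∈ Finset.range n, MeasurableSpace.comap (W i) inferInstance := fun {i n} hi =>
    le_iSup₂_of_le (f := fun j (_ : j ∈ Finset.range n) =>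
      MeasurableSpace.comap (W j) inferInstance) i (Finset.mem_range.2 hi) le_rfl
  induction t, ht using Nat.le_induction with
  | base =>
    rw [hX1]
    exact ⟨hW_mem 0 (by omega), (comap_measurable (W 0)).mono (hcomap one_pos) le_rfl⟩
  | succ t ht ih =>
    obtain ⟨hmem, hmeas⟩ := ih (by omega)
    have hle : (⨆ i ∈ Finset.range t, MeasurableSpace.comap (W i) inferInstance) ≤
        ⨆ i ∈ Finset.range (t + 1), MeasurableSpace.comap (W i) inferInstance :=
      biSup_mono fun i hi => Finset.range_mono (Nat.le_succ t) hi
    have hhat : Measurable[𝒢 t] (Xhat t) := by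
      rw [hXhat t ht (by omega)]
      exact stronglyMeasurable_condExp.measurable
    have hhat2 : MemLp (Xhat t) 2 μ := by
      rw [hXhat t ht (by omega)]
      exact hmem.condExp one_le_two
    rw [hXrec t ht (by omega), hU t ht (by omega)]
    exact ⟨((hmem.const_mul a).add (hW_mem t (by omega))).add (hhat2.const_mul _),
      (((hmeas.mono hle le_rfl).const_mul a).add
        ((comap_measurable (W t)).mono (hcomap (Nat.lt_succ_self t)) le_rfl)).add
        ((hhat.mono ((h𝒢_le t ht (by omega)).trans hle) le_rfl).const_mul _)⟩

/-- The separated cost decomposition for certainty-equivalent control, before averaging. -/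
lemma closedLoop_cost_eq [IsProbabilityMeasure μ] (hT : 1 ≤ T)
    {q r s g : ℕ → ℝ}
    (hq : ∀ t, 1 ≤ t → t ≤ T → 0 ≤ q t)
    (hr : ∀ t, 1 ≤ t → t ≤ T - 1 → 0 < r t)
    (hsT1 : s (T + 1) = 0) (hsT : s T = q T)
    (hs : ∀ t, 1 ≤ t → t ≤ T - 1 →
      s t = q t + a ^ 2 * s (t + 1) * r t / (s (t + 1) + r t))
    (hk : ∀ t, 1 ≤ t → t ≤ T - 1 → k t = a * s (t + 1) / (s (t + 1) + r t))
    (hg : ∀ t, 1 ≤ t → t ≤ T → g t = a ^ 2 * s (t + 1) - s t + q t)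
    (hW_meas : ∀ t, Measurable (W t))
    (hW_mem : ∀ t, t ≤ T - 1 → MemLp (W t) 2 μ)
    (hW_mean : ∀ t, t ≤ T - 1 → ∫ ω, W t ω ∂μ = 0)
    (hW_indep : ProbabilityTheory.iIndepFun W μ)
    (h𝒢_le : ∀ t, 1 ≤ t → t ≤ T →
      𝒢 t ≤ ⨆ i ∈ Finset.range t, MeasurableSpace.comap (W i) inferInstance)
    (hX1 : X 1 = W 0)
    (hXhat : ∀ t, 1 ≤ t → t ≤ T → Xhat t = μ[X t|𝒢 t])
    (hU : ∀ t, 1 ≤ t → t ≤ T - 1 → U t = fun ω => -(k t) * Xhat t ω)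
    (hXrec : ∀ t, 1 ≤ t → t ≤ T - 1 →
      X (t + 1) = fun ω => a * X t ω + W t ω + U t ω) :
    ∫ ω, (q T * X T ω ^ 2 +
          ∑ t ∈ Finset.Icc 1 (T - 1), (q t * X t ω ^ 2 + r t * U t ω ^ 2)) ∂μ =
      ∑ t ∈ Finset.Icc 1 T,
        (s t * ∫ ω, W (t - 1) ω ^ 2 ∂μ +
          g t * ∫ ω, (X t ω - Xhat t ω) ^ 2 ∂μ) := by
  have hreg : ∀ t, 1 ≤ t → t ≤ T → _ := fun t ht htT =>
    closedLoop_state_regular hW_mem h𝒢_le hX1 hXhat hU hXrec ht htT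
  have h𝒢 : ∀ t, 1 ≤ t → t ≤ T → 𝒢 t ≤ m0 := fun t ht htT =>
    (h𝒢_le t ht htT).trans (iSup₂_le fun i _ => (hW_meas i).comap_le)
  have hUmem : ∀ t, 1 ≤ t → t ≤ T - 1 → MemLp (U t) 2 μ := fun t ht htT => by
    rw [hU t ht htT, hXhat t ht (by omega)]
    exact MemLp.const_mul ((hreg t ht (by omega)).1.condExp one_le_two) _
  have hcostInt : ∀ t ∈ Finset.Icc 1 (T - 1),
      Integrable (fun ω => q t * X t ω ^ 2 + r t * U t ω ^ 2) μ := fun t ht => by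
    rw [Finset.mem_Icc] at ht
    exact ((hreg t ht.1 (by omega)).1.integrable_sq.const_mul _).add
      ((hUmem t ht.1 ht.2).integrable_sq.const_mul _)
  have hstep : ∀ t, 1 ≤ t → t ≤ T - 1 →
      s (t + 1) * ∫ ω, X (t + 1) ω ^ 2 ∂μ + ∫ ω, (q t * X t ω ^ 2 + r t * U t ω ^ 2) ∂μ =
        s t * ∫ ω, X t ω ^ 2 ∂μ + s (t + 1) * ∫ ω, W t ω ^ 2 ∂μ +
          g t * ∫ ω, (X t ω - Xhat t ω) ^ 2 ∂μ := fun t ht htT => by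
    have hX := hreg t ht (by omega)
    have hhat : Measurable[𝒢 t] (μ[X t|𝒢 t]) := stronglyMeasurable_condExp.measurable
    have hnext := integral_next_state_sq (h𝒢 t ht (by omega)) hX.1 (hW_mem t htT)
      (hW_mean t htT) (a := a) (k := k t) (indepFun_of_measurable_past hW_meas hW_indep
        ((hX.2.const_mul a).sub ((hhat.mono (h𝒢_le t ht (by omega)) le_rfl).const_mul _)))
    have herr := integral_sub_condExp_sq (h𝒢 t ht (by omega)) hX.1
    have hU2 : ∫ ω, U t ω ^ 2 ∂μ = k t ^ 2 * ∫ ω, (μ[X t|𝒢 t]) ω ^ 2 ∂μ := by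
      rw [hU t ht htT, hXhat t ht (by omega), ← integral_const_mul]
      simp only [mul_pow, neg_sq]
    rw [integral_add (hX.1.integrable_sq.const_mul _)
        ((hUmem t ht htT).integrable_sq.const_mul _), integral_const_mul, integral_const_mul, hU2,
      hXrec t ht htT, hU t ht htT, hXhat t ht (by omega), hnext, herr, hg t ht (by omega),
      hs t ht htT, hk t ht htT]
    have hpos : s (t + 1) + r t ≠ 0 := (add_pos_of_nonneg_of_pos
      (riccati_nonneg hT hq hr hsT hs (by omega) (by omega)) (hr t ht htT)).ne'
    field_simp
    ring
  have htel : ∀ n, n ≤ T - 1 →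
      s (n + 1) * ∫ ω, X (n + 1) ω ^ 2 ∂μ +
          ∑ t ∈ Finset.Icc 1 n, ∫ ω, (q t * X t ω ^ 2 + r t * U t ω ^ 2) ∂μ =
        s (n + 1) * ∫ ω, W n ω ^ 2 ∂μ + ∑ t ∈ Finset.Icc 1 n,
          (s t * ∫ ω, W (t - 1) ω ^ 2 ∂μ + g t * ∫ ω, (X t ω - Xhat t ω) ^ 2 ∂μ) := by
    intro n hn
    induction n with
    | zero => simp [hX1]
    | succ n ih =>
      rw [Finset.sum_Icc_succ_top (by omega), Finset.sum_Icc_succ_top (by omega),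
        Nat.add_sub_cancel]
      linarith [ih (by omega), hstep (n + 1) (by omega) hn]
  have hgT : g T = 0 := by rw [hg T hT le_rfl, hsT1, hsT]; ring
  rw [integral_add ((hreg T hT le_rfl).1.integrable_sq.const_mul _)
    (integrable_finsetSum _ hcostInt), integral_finsetSum _ hcostInt, integral_const_mul, ← hsT]
  obtain ⟨N, rfl⟩ := Nat.exists_eq_add_of_le' hT
  rw [Finset.sum_Icc_succ_top (by omega), hgT, Nat.add_sub_cancel, htel N (by simp)]
  ring

end ClosedLoop

/-- **Separated form of the optimal cost decomposition.** Under the hypotheses of the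
cost identity for the certainty-equivalent controller, the time-averaged cost satisfies
`J̄_T = (1/T)·Σ_{t=1}^{T} ( s_t σ²_{t−1} + g_t E[(X_t − X̂_t)²] )` with
`σ²_{t−1} = E[W_{t−1}²]`; the weights satisfy `g_t = a² s_{t+1}²/(s_{t+1} + r_t) ≥ 0`
(and `g_T = 0`), and consequently, among all controllers of the form `U_t = −k_t X̂_t`
with the given gains (driven by the same disturbances), the cost is minimized by
minimizing the estimation errors `E[(X_t − X̂_t)²]`, since the term `Σ_t s_t σ²_{t−1}`
does not depend on the communication scheme. -/
theorem separated_cost_decomposition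
    {Ω : Type*} {m0 : MeasurableSpace Ω} (μ : Measure Ω) [IsProbabilityMeasure μ]
    (a : ℝ) (T : ℕ) (hT : 1 ≤ T)
    (q r s k g : ℕ → ℝ)
    (hq : ∀ t, 1 ≤ t → t ≤ T → 0 ≤ q t)
    (hr : ∀ t, 1 ≤ t → t ≤ T - 1 → 0 < r t)
    (hsT1 : s (T + 1) = 0) (hsT : s T = q T)
    (hs : ∀ t, 1 ≤ t → t ≤ T - 1 →
      s t = q t + a ^ 2 * s (t + 1) * r t / (s (t + 1) + r t))
    (hk : ∀ t, 1 ≤ t → t ≤ T - 1 → k t = a * s (t + 1) / (s (t + 1) + r t))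
    (hkT : k T = 0)
    (hg : ∀ t, 1 ≤ t → t ≤ T → g t = a ^ 2 * s (t + 1) - s t + q t)
    (W : ℕ → Ω → ℝ)
    (hW_meas : ∀ t, Measurable (W t))
    (hW_mem : ∀ t, t ≤ T - 1 → MemLp (W t) 2 μ)
    (hW_mean : ∀ t, t ≤ T - 1 → ∫ ω, W t ω ∂μ = 0)
    (hW_indep : ProbabilityTheory.iIndepFun W μ)
    (𝒢 : ℕ → MeasurableSpace Ω)
    (h𝒢_mono : ∀ t t', 1 ≤ t → t ≤ t' → t' ≤ T → 𝒢 t ≤ 𝒢 t')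
    (h𝒢_le : ∀ t, 1 ≤ t → t ≤ T →
      𝒢 t ≤ ⨆ i ∈ Finset.range t, MeasurableSpace.comap (W i) inferInstance)
    (X Xhat U : ℕ → Ω → ℝ)
    (hX1 : X 1 = W 0)
    (hXhat : ∀ t, 1 ≤ t → t ≤ T → Xhat t = μ[X t|𝒢 t])
    (hU : ∀ t, 1 ≤ t → t ≤ T - 1 → U t = fun ω => -(k t) * Xhat t ω)
    (hXrec : ∀ t, 1 ≤ t → t ≤ T - 1 →
      X (t + 1) = fun ω => a * X t ω + W t ω + U t ω) :
    (1 / (T : ℝ)) * ∫ ω, (q T * X T ω ^ 2 +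
          ∑ t ∈ Finset.Icc 1 (T - 1), (q t * X t ω ^ 2 + r t * U t ω ^ 2)) ∂μ =
      (1 / (T : ℝ)) * ∑ t ∈ Finset.Icc 1 T,
        (s t * ∫ ω, W (t - 1) ω ^ 2 ∂μ +
          g t * ∫ ω, (X t ω - Xhat t ω) ^ 2 ∂μ) ∧
    (∀ t, 1 ≤ t → t ≤ T - 1 → g t = a ^ 2 * s (t + 1) ^ 2 / (s (t + 1) + r t)) ∧
    g T = 0 ∧
    (∀ t, 1 ≤ t → t ≤ T → 0 ≤ g t) ∧
    (∀ 𝒢' : ℕ → MeasurableSpace Ω, ∀ X' Xhat' U' : ℕ → Ω → ℝ,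
      (∀ t t', 1 ≤ t → t ≤ t' → t' ≤ T → 𝒢' t ≤ 𝒢' t') →
      (∀ t, 1 ≤ t → t ≤ T →
        𝒢' t ≤ ⨆ i ∈ Finset.range t, MeasurableSpace.comap (W i) inferInstance) →
      X' 1 = W 0 →
      (∀ t, 1 ≤ t → t ≤ T → Xhat' t = μ[X' t|𝒢' t]) →
      (∀ t, 1 ≤ t → t ≤ T - 1 → U' t = fun ω => -(k t) * Xhat' t ω) →
      (∀ t, 1 ≤ t → t ≤ T - 1 →
        X' (t + 1) = fun ω => a * X' t ω + W t ω + U' t ω) →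
      (∀ t, 1 ≤ t → t ≤ T →
        ∫ ω, (X t ω - Xhat t ω) ^ 2 ∂μ ≤ ∫ ω, (X' t ω - Xhat' t ω) ^ 2 ∂μ) →
      (1 / (T : ℝ)) * ∫ ω, (q T * X T ω ^ 2 +
            ∑ t ∈ Finset.Icc 1 (T - 1), (q t * X t ω ^ 2 + r t * U t ω ^ 2)) ∂μ ≤
        (1 / (T : ℝ)) * ∫ ω, (q T * X' T ω ^ 2 +
            ∑ t ∈ Finset.Icc 1 (T - 1), (q t * X' t ω ^ 2 + r t * U' t ω ^ 2)) ∂μ) := by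
  have hsn : ∀ t, 1 ≤ t → t ≤ T → 0 ≤ s t := fun t ht htT =>
    riccati_nonneg hT hq hr hsT hs ht htT
  have hgT : g T = 0 := by rw [hg T hT le_rfl, hsT1, hsT]; ring
  have hg' : ∀ t, 1 ≤ t → t ≤ T - 1 → g t = a ^ 2 * s (t + 1) ^ 2 / (s (t + 1) + r t) := by
    intro t ht htT
    have hpos : s (t + 1) + r t ≠ 0 :=
      (add_pos_of_nonneg_of_pos (hsn (t + 1) (by omega) (by omega)) (hr t ht htT)).ne'
    rw [hg t ht (by omega), hs t ht htT]
    field_simp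
    ring
  have hg0 : ∀ t, 1 ≤ t → t ≤ T → 0 ≤ g t := by
    intro t ht htT
    rcases htT.eq_or_lt with rfl | hlt
    · exact hgT.ge
    · have h₁ := hsn (t + 1) (by omega) (by omega)
      have h₂ := hr t ht (by omega)
      rw [hg' t ht (by omega)]
      positivity
  have hcost := closedLoop_cost_eq hT hq hr hsT1 hsT hs hk hg hW_meas hW_mem hW_mean hW_indep
    h𝒢_le hX1 hXhat hU hXrec
  refine ⟨by rw [hcost], hg', hgT, hg0, ?_⟩
  intro 𝒢' X' Xhat' U' _ h𝒢_le' hX1' hXhat' hU' hXrec' herr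
  rw [hcost, closedLoop_cost_eq hT hq hr hsT1 hsT hs hk hg hW_meas hW_mem hW_mean hW_indep
    h𝒢_le' hX1' hXhat' hU' hXrec']
  refine mul_le_mul_of_nonneg_left (Finset.sum_le_sum fun t ht => ?_) (by positivity)
  rw [Finset.mem_Icc] at ht
  have := mul_le_mul_of_nonneg_left (herr t ht.1 ht.2) (hg0 t ht.1 ht.2)
  gcongr
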